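/- Let A be a symmetric n×n real matrix, ζ* ∈ {0,1}ⁿ with Σᵢ ζ*ᵢ = γn, Z* = ζ*(ζ*)ᵀ, and C* = {i : ζ*ᵢ = 1}. Suppose there exist a diagonal matrix D* = diag{d*ᵢ} with all d*ᵢ ≥ 0, a matrix B* ∈ ℝⁿˣⁿ with all entries ≥ 0, and λ*, η* ∈ ℝ such that S* = D* − B* − A + η*I + λ*J satisfies: S* is positive semidefinite, the second smallest eigenvalue of S* is strictly positive, S*ζ* = 0, d*ᵢ(Z*ᵢᵢ − 1) = 0 for all i, and B*ᵢⱼ Z*ᵢⱼ = 0 for all i, j. Then Z* is the unique maximizer of ⟨A, Z⟩ over the set {Z ∈ ℝⁿˣⁿ : Z positive semidefinite, Zᵢᵢ ≤ 1 for all i, Zᵢⱼ ≥ 0 for all i,j, ⟨I, Z⟩ = γn, ⟨J, Z⟩ = γ²n²}. -/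

import Mathlib

open Matrix

/-- The trace inner product `⟨X, Y⟩ = Tr(Xᵀ Y)`. -/
noncomputable def mtip {n : ℕ} (X Y : Matrix (Fin n) (Fin n) ℝ) : ℝ := (Xᵀ * Y).trace

/-- The eigenvalues of a Hermitian (real symmetric) matrix, sorted in nondecreasing
order, as a list. -/
noncomputable def sortedEigenvalues {n : ℕ} {S : Matrix (Fin n) (Fin n) ℝ}
    (hS : S.IsHermitian) : List ℝ :=
  (Finset.univ.val.map hS.eigenvalues).sort (· ≤ ·)

/-- The second smallest eigenvalue (counted with multiplicity) of a Hermitian matrix. -/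
noncomputable def secondSmallestEigenvalue {n : ℕ} {S : Matrix (Fin n) (Fin n) ℝ}
    (hS : S.IsHermitian) : ℝ :=
  (sortedEigenvalues hS).getD 1 0

open scoped MatrixOrder ComplexOrder in
/-- Every positive semidefinite real matrix is a Gram matrix. -/
lemma Matrix.PosSemidef.exists_eq_conjTranspose_mul_self {n : ℕ} {S : Matrix (Fin n) (Fin n) ℝ}
    (hS : S.PosSemidef) : ∃ R : Matrix (Fin n) (Fin n) ℝ, S = Rᴴ * R :=
  CStarAlgebra.nonneg_iff_eq_star_mul_self.mp hS.nonneg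

lemma trace_conjTranspose_mul_self_mul {n : ℕ} (R Q : Matrix (Fin n) (Fin n) ℝ) :
    ((Rᴴ * R) * (Qᴴ * Q)).trace = ((R * Qᴴ) * (R * Qᴴ)ᴴ).trace := by
  rw [Matrix.mul_assoc, Matrix.trace_mul_comm, Matrix.conjTranspose_mul,
    Matrix.conjTranspose_conjTranspose]
  simp only [Matrix.mul_assoc]

lemma Matrix.PosSemidef.trace_mul_nonneg {n : ℕ} {S Z : Matrix (Fin n) (Fin n) ℝ}
    (hS : S.PosSemidef) (hZ : Z.PosSemidef) : 0 ≤ (S * Z).trace := by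
  obtain ⟨R, rfl⟩ := hS.exists_eq_conjTranspose_mul_self
  obtain ⟨Q, rfl⟩ := hZ.exists_eq_conjTranspose_mul_self
  rw [trace_conjTranspose_mul_self_mul]
  exact (posSemidef_self_mul_conjTranspose _).trace_nonneg

lemma Matrix.PosSemidef.mul_eq_zero_of_trace_mul_eq_zero {n : ℕ}
    {S Z : Matrix (Fin n) (Fin n) ℝ} (hS : S.PosSemidef) (hZ : Z.PosSemidef)
    (h : (S * Z).trace = 0) : S * Z = 0 := by
  obtain ⟨R, rfl⟩ := hS.exists_eq_conjTranspose_mul_self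
  obtain ⟨Q, rfl⟩ := hZ.exists_eq_conjTranspose_mul_self
  rw [trace_conjTranspose_mul_self_mul, Matrix.trace_mul_conjTranspose_self_eq_zero_iff] at h
  rw [Matrix.mul_assoc, ← Matrix.mul_assoc R, h, Matrix.zero_mul, Matrix.mul_zero]

/-- A sorted list whose second entry is positive contains `0` at most once. -/
lemma List.Pairwise.count_zero_le_one {l : List ℝ} (hl : l.Pairwise (· ≤ ·))
    (h : 0 < l.getD 1 0) : l.count 0 ≤ 1 := by
  match l, hl, h with
  | [], _, _ => simp
  | [_], _, h => simp at h
  | a :: b :: t, hl, h =>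
    have hb : 0 < b := by simpa using h
    have ht : (b :: t).count 0 = 0 := by
      rw [List.count_eq_zero]
      intro h0
      rcases List.mem_cons.mp h0 with h0 | h0
      · exact hb.ne h0
      · exact hb.not_ge ((List.pairwise_cons.mp (List.pairwise_cons.mp hl).2).1 0 h0)
    rw [List.count_cons, ht]
    split <;> simp

lemma card_zero_eigenvalues_le_one {n : ℕ} {S : Matrix (Fin n) (Fin n) ℝ} (hS : S.IsHermitian)
    (hgap : 0 < secondSmallestEigenvalue hS) :
    Fintype.card {i // hS.eigenvalues i = 0} ≤ 1 := by
  have h : (sortedEigenvalues hS).count 0 ≤ 1 :=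
    List.Pairwise.count_zero_le_one (Multiset.pairwise_sort _ _) hgap
  rw [← Multiset.coe_count, sortedEigenvalues, Multiset.sort_eq, Multiset.count_map] at h
  rw [Fintype.card_subtype]
  simpa only [Finset.card_def, Finset.filter_val, eq_comm] using h

/-- If the second smallest eigenvalue is positive, the kernel is at most a line. -/
lemma exists_smul_eq_of_mulVec_eq_zero {n : ℕ} {S : Matrix (Fin n) (Fin n) ℝ}
    (hS : S.IsHermitian) (hgap : 0 < secondSmallestEigenvalue hS) {v w : Fin n → ℝ}
    (hv : S *ᵥ v = 0) (hv0 : v ≠ 0) (hw : S *ᵥ w = 0) : ∃ c : ℝ, w = c • v := by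
  have hrank := hS.rank_eq_card_non_zero_eigs
  have hcard := card_zero_eigenvalues_le_one hS hgap
  have hcompl := Fintype.card_subtype_compl (fun i => hS.eigenvalues i = 0)
  have hsum := S.mulVecLin.finrank_range_add_finrank_ker
  rw [Module.finrank_fin_fun] at hsum
  rw [Fintype.card_fin] at hcompl
  change Module.finrank ℝ (LinearMap.range S.mulVecLin) = _ at hrank
  have hker : Module.finrank ℝ (LinearMap.ker S.mulVecLin) ≤ 1 := by
    simp only [ne_eq] at hrank
    omega
  obtain ⟨u, hu⟩ := finrank_le_one_iff.mp hker
  obtain ⟨a, ha⟩ := hu ⟨v, hv⟩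
  obtain ⟨b, hb⟩ := hu ⟨w, hw⟩
  have ha' : a • (u : Fin n → ℝ) = v := congrArg Subtype.val ha
  have hb' : b • (u : Fin n → ℝ) = w := congrArg Subtype.val hb
  have ha0 : a ≠ 0 := by
    rintro rfl
    exact hv0 (by rw [← ha', zero_smul])
  exact ⟨b / a, by rw [← ha', ← hb', smul_smul, div_mul_cancel₀ b ha0]⟩

lemma mtip_eq_sum {n : ℕ} (X Y : Matrix (Fin n) (Fin n) ℝ) :
    mtip X Y = ∑ i, ∑ j, X i j * Y i j := by
  simp only [mtip, Matrix.trace, Matrix.diag_apply, Matrix.mul_apply, Matrix.transpose_apply]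
  exact Finset.sum_comm

lemma mtip_one {n : ℕ} (Z : Matrix (Fin n) (Fin n) ℝ) : mtip 1 Z = Z.trace := by
  simp [mtip]

lemma mtip_dual {n : ℕ} (d : Fin n → ℝ) (A B Z : Matrix (Fin n) (Fin n) ℝ) (lam eta : ℝ) :
    mtip (Matrix.diagonal d - B - A + eta • (1 : Matrix (Fin n) (Fin n) ℝ) +
      lam • Matrix.of (fun _ _ => (1 : ℝ))) Z =
      ∑ i, d i * Z i i - mtip B Z - mtip A Z + eta * mtip 1 Z +
        lam * mtip (Matrix.of fun _ _ => (1 : ℝ)) Z := by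
  have hdiag : (Matrix.diagonal d * Z).trace = ∑ i, d i * Z i i := by
    simp [Matrix.trace]
  simp only [mtip, Matrix.transpose_add, Matrix.transpose_sub, Matrix.transpose_smul,
    Matrix.diagonal_transpose, Matrix.add_mul, Matrix.sub_mul, Matrix.smul_mul, Matrix.trace_add,
    Matrix.trace_sub, Matrix.trace_smul, smul_eq_mul, hdiag]

/-- A symmetric matrix whose columns are all multiples of `v` is a multiple of `v vᵀ`. -/
lemma eq_smul_vecMulVec_of_col {n : ℕ} {Z : Matrix (Fin n) (Fin n) ℝ} (hZ : Z.IsSymm)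
    {v : Fin n → ℝ} (hv : v ≠ 0) (h : ∀ j, ∃ c : ℝ, Z.col j = c • v) :
    ∃ c : ℝ, Z = c • vecMulVec v v := by
  choose c hc using h
  have hent : ∀ i j, Z i j = c j * v i := fun i j => congrFun (hc j) i
  obtain ⟨k, hk⟩ := Function.ne_iff.mp hv
  have hk : v k ≠ 0 := hk
  refine ⟨c k / v k, ?_⟩
  ext i j
  have hcj : c j * v k = c k * v j := by rw [← hent, ← hent, hZ.apply]
  simp only [Matrix.smul_apply, vecMulVec_apply, smul_eq_mul]
  rw [hent, div_mul_eq_mul_div, eq_div_iff hk]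
  linear_combination v i * hcj

/-- **Deterministic dual certificate for the SDP relaxation in the GWPDSM.**
If there are `D* = diag(d) ⪰ 0` (entrywise), `B* ≥ 0` (entrywise) and `λ*, η*` such that
`S* = D* − B* − A + η*I + λ*J` is PSD with `λ₂(S*) > 0`, `S*ζ* = 0`, and the
complementary slackness conditions `d*ᵢ(Z*ᵢᵢ − 1) = 0` and `B*ᵢⱼ Z*ᵢⱼ = 0` hold, then
`Z* = ζ*(ζ*)ᵀ` is the unique maximizer of `⟨A, Z⟩` over
`{Z : Z ⪰ 0, Zᵢᵢ ≤ 1, Zᵢⱼ ≥ 0, ⟨I, Z⟩ = γn, ⟨J, Z⟩ = γ²n²}`. -/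
theorem pdsm_sdp_dual_certificate (n : ℕ) (γ : ℝ) (hγ0 : 0 < γ) (hγ1 : γ < 1)
    (A : Matrix (Fin n) (Fin n) ℝ) (hA : A.IsSymm)
    (ζs : Fin n → ℝ) (hζ : ∀ i, ζs i = 0 ∨ ζs i = 1) (hcard : ∑ i, ζs i = γ * n)
    (d : Fin n → ℝ) (hd : ∀ i, 0 ≤ d i)
    (B : Matrix (Fin n) (Fin n) ℝ) (hB : ∀ i j, 0 ≤ B i j)
    (lam eta : ℝ)
    (S : Matrix (Fin n) (Fin n) ℝ)
    (hS : S = Matrix.diagonal d - B - A + eta • (1 : Matrix (Fin n) (Fin n) ℝ) +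
      lam • Matrix.of (fun _ _ => (1 : ℝ)))
    (hPSD : S.PosSemidef)
    (hgap : 0 < secondSmallestEigenvalue hPSD.isHermitian)
    (hker : S.mulVec ζs = 0)
    (hslackD : ∀ i, d i * (vecMulVec ζs ζs i i - 1) = 0)
    (hslackB : ∀ i j, B i j * vecMulVec ζs ζs i j = 0) :
    ((vecMulVec ζs ζs).PosSemidef ∧ (∀ i, vecMulVec ζs ζs i i ≤ 1) ∧
      (∀ i j, 0 ≤ vecMulVec ζs ζs i j) ∧
      mtip 1 (vecMulVec ζs ζs) = γ * n ∧
      mtip (Matrix.of fun _ _ => (1 : ℝ)) (vecMulVec ζs ζs) = γ ^ 2 * (n : ℝ) ^ 2) ∧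
    ∀ Z : Matrix (Fin n) (Fin n) ℝ,
      Z.PosSemidef → (∀ i, Z i i ≤ 1) → (∀ i j, 0 ≤ Z i j) →
      mtip 1 Z = γ * n → mtip (Matrix.of fun _ _ => (1 : ℝ)) Z = γ ^ 2 * (n : ℝ) ^ 2 →
      Z ≠ vecMulVec ζs ζs → mtip A Z < mtip A (vecMulVec ζs ζs) := by
  have hsq : ∀ i, ζs i * ζs i = ζs i := fun i => by rcases hζ i with h | h <;> simp [h]
  have hnonneg : ∀ i, 0 ≤ ζs i := fun i => by rcases hζ i with h | h <;> simp [h]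
  have hle : ∀ i, ζs i ≤ 1 := fun i => by rcases hζ i with h | h <;> simp [h]
  have htrace : mtip 1 (vecMulVec ζs ζs) = γ * n := by
    rw [mtip_one, ← hcard]
    simp [Matrix.trace, vecMulVec_apply, hsq]
  have hJ : mtip (Matrix.of fun _ _ => (1 : ℝ)) (vecMulVec ζs ζs) = γ ^ 2 * (n : ℝ) ^ 2 := by
    rw [← mul_pow, ← hcard, mtip_eq_sum, sq, Finset.sum_mul_sum]
    simp [vecMulVec_apply]
  have hn : n ≠ 0 := by
    rintro rfl
    simp [secondSmallestEigenvalue, sortedEigenvalues] at hgap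
  have hγn : 0 < γ * n := by positivity
  have hζ0 : ζs ≠ 0 := by
    rintro rfl
    simp [← hcard] at hγn
  refine ⟨⟨by simpa using posSemidef_vecMulVec_self_star ζs,
    fun i => by simpa [vecMulVec_apply, hsq] using hle i,
    fun i j => by simpa [vecMulVec_apply] using mul_nonneg (hnonneg i) (hnonneg j),
    htrace, hJ⟩, fun Z hZ hZd hZ0 hZI hZJ hne => ?_⟩
  have hSsymm : Sᵀ = S := by simpa using hPSD.isHermitian.eq
  have hSζ : mtip S (vecMulVec ζs ζs) = 0 := by
    rw [mtip, hSsymm, mul_vecMulVec, hker, zero_vecMulVec, trace_zero]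
  have hBζ : mtip B (vecMulVec ζs ζs) = 0 := by
    simp [mtip_eq_sum, hslackB]
  have hdζ : ∑ i, d i * vecMulVec ζs ζs i i = ∑ i, d i :=
    Finset.sum_congr rfl fun i _ => by linear_combination hslackD i
  have hdZ : ∑ i, d i * Z i i ≤ ∑ i, d i :=
    Finset.sum_le_sum fun i _ => mul_le_of_le_one_right (hd i) (hZd i)
  have hBZ : 0 ≤ mtip B Z := by
    rw [mtip_eq_sum]
    exact Finset.sum_nonneg fun i _ => Finset.sum_nonneg fun j _ => mul_nonneg (hB i j) (hZ0 i j)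
  have hSZ : 0 < mtip S Z := by
    rw [mtip, hSsymm]
    refine (hPSD.trace_mul_nonneg hZ).lt_of_ne' fun h0 => hne ?_
    have hmul := hPSD.mul_eq_zero_of_trace_mul_eq_zero hZ h0
    obtain ⟨c, hc⟩ := eq_smul_vecMulVec_of_col (by simpa using hZ.isHermitian.eq : Zᵀ = Z) hζ0 fun j =>
      exists_smul_eq_of_mulVec_eq_zero hPSD.isHermitian hgap hker hζ0
        (w := Z.col j) (funext fun i => congrFun (congrFun hmul i) j)
    have hc1 : c = 1 := by
      rw [hc, mtip_one, trace_smul, ← mtip_one, htrace, smul_eq_mul] at hZI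
      exact (mul_eq_right₀ hγn.ne').mp hZI
    rw [hc, hc1, one_smul]
  have hdualZ := mtip_dual d A B Z lam eta
  have hdualζ := mtip_dual d A B (vecMulVec ζs ζs) lam eta
  rw [← hS, hZI, hZJ] at hdualZ
  rw [← hS, htrace, hJ, hSζ, hBζ, hdζ] at hdualζ
  linarith
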